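/- arXiv:1512.00101 — 4 statements merged into one kernel-verified Lean document; each statement's English description precedes it below -/
import Mathlib

section
/- Let G be an s–t network with internal vertex set 𝒱 and nonnegative capacity function c. Then its cut-cost function has the multilinear (quadratic) expansion f_G(x) = l_0 + Σ_{i∈𝒱} l_i x_i + Σ_{i,j∈𝒱} l_{ij} x_i x_j for all x ∈ {0,1}^𝒱, where l_0 = Σ_{j∈𝒱} c(j,t), l_i = c(s,i) − c(i,t) + Σ_{k∈𝒱} c(k,i), and l_{ij} = −c(i,j); in particular every quadratic coefficient l_{ij} is nonpositive. -/
/-!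
An s–t network `G` on internal vertex type `ι` is modeled by a finite set
`verts` of internal vertices together with nonnegative capacities
`cs i = c(s,i)` (source links), `ct i = c(i,t)` (sink links) and
`cn i j = c(i,j)` (internal edges), supported on `verts`
(capacities into `s` and out of `t` are `0`).
-/
structure STNetwork (ι : Type) where
  verts : Finset ι
  cs : ι → ℝ
  ct : ι → ℝ
  cn : ι → ι → ℝ
  cs_nonneg : ∀ i, 0 ≤ cs i
  ct_nonneg : ∀ i, 0 ≤ ct i
  cn_nonneg : ∀ i j, 0 ≤ cn i j
  cs_support : ∀ i, cs i ≠ 0 → i ∈ verts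
  ct_support : ∀ i, ct i ≠ 0 → i ∈ verts
  cn_support : ∀ i j, cn i j ≠ 0 → i ∈ verts ∧ j ∈ verts

/-- The real value of a Boolean: `true ↦ 1`, `false ↦ 0`. -/
def bval (b : Bool) : ℝ := if b then 1 else 0

/-- The cut-cost function `f_G` of an s–t network: a Boolean assignment
`x` encodes the cut `S = {s} ∪ {i : x i = false}`, `T = {t} ∪ {j : x j = true}`,
whose cost is the sum of capacities of edges from `S` to `T`. -/
noncomputable def cutCost {ι : Type} (G : STNetwork ι) (x : ι → Bool) : ℝ :=
  (∑ j ∈ G.verts.filter (fun j => x j = true), G.cs j)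
  + (∑ i ∈ G.verts.filter (fun i => x i = false), G.ct i)
  + ∑ i ∈ G.verts.filter (fun i => x i = false),
      ∑ j ∈ G.verts.filter (fun j => x j = true), G.cn i j

/-- Constant multilinear coefficient `l_0 = Σ_{j∈𝒱} c(j,t)`. -/
noncomputable def coeff0 {ι : Type} (G : STNetwork ι) : ℝ := ∑ j ∈ G.verts, G.ct j

/-- Linear multilinear coefficient `l_i = c(s,i) − c(i,t) + Σ_{k∈𝒱} c(k,i)`. -/
noncomputable def coeffLin {ι : Type} (G : STNetwork ι) (i : ι) : ℝ :=
  G.cs i - G.ct i + ∑ k ∈ G.verts, G.cn k i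

/-- Quadratic multilinear coefficient `l_{ij} = −c(i,j)`. -/
noncomputable def coeffQuad {ι : Type} (G : STNetwork ι) (i j : ι) : ℝ := - G.cn i j

theorem sum_filter_true_eq {ι : Type} (s : Finset ι) (x : ι → Bool) (f : ι → ℝ) :
    ∑ i ∈ s.filter (fun i => x i = true), f i = ∑ i ∈ s, f i * bval (x i) := by
  rw [Finset.sum_filter]
  exact Finset.sum_congr rfl fun i _ => by cases x i <;> simp [bval]

theorem sum_filter_false_eq {ι : Type} (s : Finset ι) (x : ι → Bool) (f : ι → ℝ) :
    ∑ i ∈ s.filter (fun i => x i = false), f i = ∑ i ∈ s, f i * (1 - bval (x i)) := by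
  rw [Finset.sum_filter]
  exact Finset.sum_congr rfl fun i _ => by cases x i <;> simp [bval]

/-- The cut-cost function of an s–t network `G` has the
multilinear (quadratic) expansion
`f_G(x) = l_0 + Σ_i l_i x_i + Σ_{i,j} l_{ij} x_i x_j` with
`l_0 = Σ_j c(j,t)`, `l_i = c(s,i) − c(i,t) + Σ_k c(k,i)`, `l_{ij} = −c(i,j)`;
in particular every quadratic coefficient `l_{ij}` is nonpositive. -/
theorem cutCost_multilinear {ι : Type} (G : STNetwork ι) :
    (∀ x : ι → Bool,
      cutCost G x = coeff0 G + (∑ i ∈ G.verts, coeffLin G i * bval (x i))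
        + ∑ i ∈ G.verts, ∑ j ∈ G.verts, coeffQuad G i j * bval (x i) * bval (x j))
    ∧ (∀ i j, coeffQuad G i j ≤ 0) := by
  refine ⟨fun x => ?_, fun i j => neg_nonpos.mpr (G.cn_nonneg i j)⟩
  have linear_part : ∑ i ∈ G.verts, (∑ k ∈ G.verts, G.cn k i) * bval (x i)
      = ∑ k ∈ G.verts, ∑ i ∈ G.verts, G.cn k i * bval (x i) := by
    rw [Finset.sum_comm]
    simp only [Finset.sum_mul]
  have quadratic_part : ∑ i ∈ G.verts, ∑ j ∈ G.verts, G.cn i j * bval (x i) * bval (x j)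
      = ∑ i ∈ G.verts, (∑ j ∈ G.verts, G.cn i j * bval (x j)) * bval (x i) := by
    simp only [Finset.sum_mul, mul_right_comm]
  simp only [cutCost, coeff0, coeffLin, coeffQuad, sum_filter_true_eq, sum_filter_false_eq,
    add_mul, sub_mul, mul_sub, mul_one, neg_mul, Finset.sum_add_distrib, Finset.sum_sub_distrib,
    Finset.sum_neg_distrib, linear_part, quadratic_part]
  ring
end

section
/- Let G be an s–t network that is separable with respect to (𝒱1, 𝒱2), and let G1, G2 be its split subgraphs. Then for every Boolean assignment x : 𝒱 → {0,1}, the cut cost in G of the cut encoded by x equals the sum of the cut costs in G1 and G2 of the restricted assignments: f_G(x) = f_{G1}(x|_{𝒱1}) + f_{G2}(x|_{𝒱2}). -/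
/-- `G` is separable with respect to `(V1, V2)`: `V1 ∪ V2 = 𝒱`, `V1 ∩ V2 ≠ ∅`,
and every pair with positive capacity has both endpoints in `{s,t} ∪ V1` or
both in `{s,t} ∪ V2` (for internal edges this means both internal endpoints
lie in `V1` or both lie in `V2`). -/
def Separable {ι : Type} [DecidableEq ι] (G : STNetwork ι) (V1 V2 : Finset ι) : Prop :=
  V1 ∪ V2 = G.verts ∧ (V1 ∩ V2).Nonempty ∧
  ∀ i j, G.cn i j ≠ 0 → (i ∈ V1 ∧ j ∈ V1) ∨ (i ∈ V2 ∧ j ∈ V2)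

/-- `G1, G2` are the split subgraphs of `G` with respect to `(V1, V2)`:
capacities of edges with both endpoints in `{s,t} ∪ (V1 ∩ V2)` are halved,
edges inside `{s,t} ∪ V_k` with an endpoint in `V_k` minus the other part are
inherited, and all other capacities are `0`. -/
def IsSplitOf {ι : Type} [DecidableEq ι] (G : STNetwork ι) (V1 V2 : Finset ι)
    (G1 G2 : STNetwork ι) : Prop :=
  G1.verts = V1 ∧ G2.verts = V2 ∧
  (∀ i, G1.cs i = if i ∈ V1 ∩ V2 then G.cs i / 2 else if i ∈ V1 then G.cs i else 0) ∧
  (∀ i, G1.ct i = if i ∈ V1 ∩ V2 then G.ct i / 2 else if i ∈ V1 then G.ct i else 0) ∧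
  (∀ i j, G1.cn i j = if i ∈ V1 ∩ V2 ∧ j ∈ V1 ∩ V2 then G.cn i j / 2
      else if i ∈ V1 ∧ j ∈ V1 then G.cn i j else 0) ∧
  (∀ i, G2.cs i = if i ∈ V1 ∩ V2 then G.cs i / 2 else if i ∈ V2 then G.cs i else 0) ∧
  (∀ i, G2.ct i = if i ∈ V1 ∩ V2 then G.ct i / 2 else if i ∈ V2 then G.ct i else 0) ∧
  (∀ i j, G2.cn i j = if i ∈ V1 ∩ V2 ∧ j ∈ V1 ∩ V2 then G.cn i j / 2
      else if i ∈ V2 ∧ j ∈ V2 then G.cn i j else 0)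

/-- The cut cost may be computed over any finite set containing the internal vertices. -/
theorem cutCost_eq_of_verts_subset {ι : Type} (G : STNetwork ι) {U : Finset ι}
    (hU : G.verts ⊆ U) (x : ι → Bool) :
    cutCost G x = (∑ j ∈ U.filter (fun j => x j = true), G.cs j)
      + (∑ i ∈ U.filter (fun i => x i = false), G.ct i)
      + ∑ i ∈ U.filter (fun i => x i = false),
          ∑ j ∈ U.filter (fun j => x j = true), G.cn i j := by
  have extend (b : Bool) (f : ι → ℝ) (hf : ∀ i, f i ≠ 0 → i ∈ G.verts) :
      ∑ i ∈ G.verts.filter (fun i => x i = b), f i = ∑ i ∈ U.filter (fun i => x i = b), f i := by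
    refine Finset.sum_subset (Finset.filter_subset_filter _ hU) fun i hi hi' => ?_
    by_contra h
    exact hi' (Finset.mem_filter.2 ⟨hf i h, (Finset.mem_filter.1 hi).2⟩)
  unfold cutCost
  rw [extend true _ G.cs_support, extend false _ G.ct_support, extend false]
  · congr 1
    exact Finset.sum_congr rfl fun i _ => extend true _ fun j hj => (G.cn_support i j hj).2
  · intro i hi
    obtain ⟨j, -, hj⟩ := Finset.exists_ne_zero_of_sum_ne_zero hi
    exact (G.cn_support i j hj).1

/-- If `G` is separable with respect to `(V1, V2)` and
`G1`, `G2` are its split subgraphs, then for every Boolean assignment `x` the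
cut cost in `G` of the cut encoded by `x` equals the sum of the cut costs in
`G1` and `G2` of the restricted assignments (the cut cost of a subgraph only
depends on the values of `x` on its internal vertices). -/
theorem cutCost_eq_sum_split {ι : Type} [DecidableEq ι]
    (G : STNetwork ι) (V1 V2 : Finset ι) (G1 G2 : STNetwork ι)
    (hsep : Separable G V1 V2) (hsplit : IsSplitOf G V1 V2 G1 G2)
    (x : ι → Bool) :
    cutCost G x = cutCost G1 x + cutCost G2 x := by
  obtain ⟨hV, -, hcn⟩ := hsep
  obtain ⟨hv1, hv2, hs1, ht1, hn1, hs2, ht2, hn2⟩ := hsplit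
  have hs (i : ι) : G.cs i = G1.cs i + G2.cs i := by
    have := G.cs_support i
    grind
  have ht (i : ι) : G.ct i = G1.ct i + G2.ct i := by
    have := G.ct_support i
    grind
  have hn (i j : ι) : G.cn i j = G1.cn i j + G2.cn i j := by
    have := hcn i j
    grind
  rw [cutCost_eq_of_verts_subset G1 (U := G.verts) (by grind),
    cutCost_eq_of_verts_subset G2 (U := G.verts) (by grind)]
  simp only [cutCost, hs, ht, hn, Finset.sum_add_distrib]
  ring
end

section
/- (Proposition 2) Let G be an s–t network, let s → i_1 → i_2 → ⋯ → i_k → t be an augmenting path whose forward-edge capacities are all at least F ≥ 0, and let G′ be the residual graph obtained by pushing flow F along this path. Then the cut-cost functions satisfy f_G(x) = f_{G′}(x) + F for every Boolean assignment x : 𝒱 → {0,1}; that is, pushing a flow F changes the cut-cost function only by subtracting the constant F. -/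
/-- The total over `A × B` of an indicator supported on the pairs `(a m, b m)`, for `a` injective,
is the sum over the index `m` of the indicators of `(a m, b m) ∈ A × B`. -/
lemma sum_sum_ite_exists_eq {α κ : Type*} [DecidableEq α] [Fintype κ]
    (a b : κ → α) [∀ i j, Decidable (∃ m, a m = i ∧ b m = j)]
    (ha : Function.Injective a) (A B : Finset α) (F : ℝ) :
    ∑ i ∈ A, ∑ j ∈ B, (if ∃ m, a m = i ∧ b m = j then F else 0)
      = ∑ m, if a m ∈ A ∧ b m ∈ B then F else 0 := by
  have key : ∀ i j, (if ∃ m, a m = i ∧ b m = j then F else 0)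
      = ∑ m, if a m = i then (if b m = j then F else 0) else 0 := by
    intro i j
    split_ifs with h
    · obtain ⟨m, rfl, rfl⟩ := h
      rw [Finset.sum_eq_single m]
      · simp
      · intro n _ hn
        rw [if_neg (fun h => hn (ha h))]
      · simp
    · refine (Finset.sum_eq_zero fun m _ => ?_).symm
      split_ifs with h1 h2
      · exact absurd ⟨m, h1, h2⟩ h
      · rfl
      · rfl
  simp_rw [key]
  rw [Finset.sum_congr rfl fun i _ => Finset.sum_comm, Finset.sum_comm]
  refine Finset.sum_congr rfl fun m _ => ?_
  rw [Finset.sum_comm]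
  simp only [Finset.sum_ite_eq]
  split_ifs <;> simp_all

/-- The net number of crossings of a cut by a path is the difference of its endpoint values. -/
lemma sum_crossings_eq_sub {k : ℕ} (y : Fin (k + 1) → Bool) (F : ℝ) :
    (∑ m : Fin k, if y m.castSucc = false ∧ y m.succ = true then F else 0)
      - (∑ m : Fin k, if y m.succ = false ∧ y m.castSucc = true then F else 0)
      = (if y (Fin.last k) = true then F else 0) - (if y 0 = true then F else 0) := by
  have h := (Fin.sum_univ_succ fun m => if y m = true then F else 0).symm.trans
    (Fin.sum_univ_castSucc fun m => if y m = true then F else 0)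
  have e : ∀ m : Fin k, (if y m.castSucc = false ∧ y m.succ = true then F else 0)
      - (if y m.succ = false ∧ y m.castSucc = true then F else 0)
      = (if y m.succ = true then F else 0) - (if y m.castSucc = true then F else 0) := by
    intro m
    cases y m.castSucc <;> cases y m.succ <;> simp
  rw [← Finset.sum_sub_distrib, Finset.sum_congr rfl fun m _ => e m, Finset.sum_sub_distrib]
  linarith

/-- **Proposition 2.** Let `s → p 0 → ⋯ → p (Fin.last k) → t` be
an augmenting path of `G` (distinct internal vertices) whose forward-edge
capacities are all at least `F ≥ 0`, and let `G'` be the residual graph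
obtained by pushing flow `F` along this path (forward capacities decreased by
`F`, reverse capacities between consecutive internal vertices increased by
`F`).  Then `f_G(x) = f_{G'}(x) + F` for every Boolean assignment `x`. -/
theorem cutCost_push_flow {ι : Type} [DecidableEq ι]
    (G G' : STNetwork ι) (k : ℕ) (p : Fin (k + 1) → ι)
    (hinj : Function.Injective p) (hmem : ∀ m, p m ∈ G.verts)
    (F : ℝ) (hF : 0 ≤ F)
    (hFs : F ≤ G.cs (p 0)) (hFt : F ≤ G.ct (p (Fin.last k)))
    (hFn : ∀ m : Fin k, F ≤ G.cn (p m.castSucc) (p m.succ))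
    (hverts : G'.verts = G.verts)
    (hcs : ∀ i, G'.cs i = G.cs i - (if i = p 0 then F else 0))
    (hct : ∀ i, G'.ct i = G.ct i - (if i = p (Fin.last k) then F else 0))
    (hcn : ∀ i j, G'.cn i j = G.cn i j
        - (if ∃ m : Fin k, p m.castSucc = i ∧ p m.succ = j then F else 0)
        + (if ∃ m : Fin k, p m.succ = i ∧ p m.castSucc = j then F else 0))
    (x : ι → Bool) :
    cutCost G x = cutCost G' x + F := by
  have hsucc := hinj.comp (Fin.succ_injective k)
  have hcast := hinj.comp (Fin.castSucc_injective k)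
  have hforward := sum_sum_ite_exists_eq (fun m : Fin k => p m.castSucc) (fun m => p m.succ) hcast
    (G.verts.filter fun i => x i = false) (G.verts.filter fun j => x j = true) F
  have hreverse := sum_sum_ite_exists_eq (fun m : Fin k => p m.succ) (fun m => p m.castSucc) hsucc
    (G.verts.filter fun i => x i = false) (G.verts.filter fun j => x j = true) F
  have hcross := sum_crossings_eq_sub (fun m => x (p m)) F
  simp only [Finset.mem_filter, hmem, true_and] at hforward hreverse
  simp only [cutCost, hverts, hcs, hct, hcn, Finset.sum_add_distrib, Finset.sum_sub_distrib,
    Finset.sum_ite_eq', Finset.mem_filter, hmem, true_and, hforward, hreverse]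
  have hlast : (if x (p (Fin.last k)) = false then F else 0)
      = F - (if x (p (Fin.last k)) = true then F else 0) := by
    cases x (p (Fin.last k)) <;> simp
  linarith
end

section
/- Let G be an s–t network and let G^{(1)} = G, G^{(2)}, …, G^{(K+1)} be a sequence of networks in which, for each m, G^{(m+1)} is the residual graph obtained from G^{(m)} by pushing a flow F_m ≥ 0 along some augmenting path of G^{(m)}. Then the cut-cost functions satisfy f_G(x) = f_{G^{(K+1)}}(x) + Σ_{m=1}^{K} F_m for every Boolean assignment x : 𝒱 → {0,1}. -/
/-- `G'` is the residual graph obtained from `G` by pushing a flow `F ≥ 0`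
along some augmenting path `s → i_1 → ⋯ → i_{k+1} → t` (with distinct internal
vertices) whose forward-edge capacities are all at least `F`: every
forward-edge capacity is decreased by `F` and every reverse capacity between
consecutive internal vertices of the path is increased by `F`. -/
def IsResidualPush {ι : Type} [DecidableEq ι] (G G' : STNetwork ι) (F : ℝ) : Prop :=
  ∃ (k : ℕ) (p : Fin (k + 1) → ι),
    Function.Injective p ∧ (∀ m, p m ∈ G.verts) ∧ 0 ≤ F ∧
    F ≤ G.cs (p 0) ∧ F ≤ G.ct (p (Fin.last k)) ∧
    (∀ m : Fin k, F ≤ G.cn (p m.castSucc) (p m.succ)) ∧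
    G'.verts = G.verts ∧
    (∀ i, G'.cs i = G.cs i - (if i = p 0 then F else 0)) ∧
    (∀ i, G'.ct i = G.ct i - (if i = p (Fin.last k) then F else 0)) ∧
    (∀ i j, G'.cn i j = G.cn i j
        - (if ∃ m : Fin k, p m.castSucc = i ∧ p m.succ = j then F else 0)
        + (if ∃ m : Fin k, p m.succ = i ∧ p m.castSucc = j then F else 0))

/-- Indicator of an edge being the image of some index under an injective source map,
summed over a rectangle, counts the indices whose edge lies in the rectangle. -/
theorem sum_sum_ite_exists_edge {ι κ : Type} [DecidableEq ι] [Fintype κ] (a b : κ → ι)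
    (ha : Function.Injective a) (S T : Finset ι) (F : ℝ)
    [∀ i j, Decidable (∃ m, a m = i ∧ b m = j)] :
    ∑ i ∈ S, ∑ j ∈ T, (if ∃ m, a m = i ∧ b m = j then F else 0)
      = ∑ m, if a m ∈ S ∧ b m ∈ T then F else 0 := by
  have key : ∀ i j, (if ∃ m, a m = i ∧ b m = j then F else 0)
      = ∑ m, if a m = i then (if b m = j then F else 0) else 0 := by
    intro i j
    split_ifs with h
    · obtain ⟨m, rfl, rfl⟩ := h
      rw [Finset.sum_eq_single m]
      · simp
      · intro n _ hn
        rw [if_neg fun h => hn (ha h)]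
      · simp
    · refine (Finset.sum_eq_zero fun m _ => ?_).symm
      split_ifs with h1 h2
      · exact absurd ⟨m, h1, h2⟩ h
      · rfl
      · rfl
  simp_rw [key]
  calc _ = ∑ i ∈ S, ∑ m, ∑ j ∈ T, (if a m = i then (if b m = j then F else 0) else 0) :=
        Finset.sum_congr rfl fun i _ => Finset.sum_comm
    _ = ∑ m, ∑ i ∈ S, ∑ j ∈ T, (if a m = i then (if b m = j then F else 0) else 0) :=
        Finset.sum_comm
    _ = _ := by
        refine Finset.sum_congr rfl fun m _ => ?_
        have hi : ∀ i, (∑ j ∈ T, if a m = i then (if b m = j then F else 0) else 0)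
            = if a m = i then (if b m ∈ T then F else 0) else 0 := by
          intro i
          split_ifs <;> simp_all
        simp_rw [hi, Finset.sum_ite_eq, ite_and]

/-- Pushing a flow `F` along an augmenting path lowers every cut cost by exactly `F`. -/
theorem IsResidualPush.cutCost_eq {ι : Type} [DecidableEq ι] {G G' : STNetwork ι} {F : ℝ}
    (h : IsResidualPush G G' F) (x : ι → Bool) : cutCost G x = cutCost G' x + F := by
  obtain ⟨k, p, hp, hv, -, -, -, -, hverts, hcs, hct, hcn⟩ := h
  unfold cutCost
  simp only [hverts, hcs, hct, hcn, Finset.sum_add_distrib, Finset.sum_sub_distrib]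
  rw [sum_sum_ite_exists_edge (fun m : Fin k => p m.castSucc) (fun m => p m.succ)
      (hp.comp (Fin.castSucc_injective k)),
    sum_sum_ite_exists_edge (fun m : Fin k => p m.succ) (fun m => p m.castSucc)
      (hp.comp (Fin.succ_injective k))]
  simp only [Finset.sum_ite_eq', Finset.mem_filter, hv, true_and]
  have hcross : (∑ m : Fin k,
        if x (p m.castSucc) = false ∧ x (p m.succ) = true then F else 0)
      - (∑ m : Fin k, if x (p m.succ) = false ∧ x (p m.castSucc) = true then F else 0)
      = bval (x (p (Fin.last k))) * F - bval (x (p 0)) * F := by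
    have htel := (Fin.sum_univ_succ fun m => bval (x (p m)) * F).symm.trans
      (Fin.sum_univ_castSucc fun m => bval (x (p m)) * F)
    have hstep : (∑ m : Fin k,
          if x (p m.castSucc) = false ∧ x (p m.succ) = true then F else 0)
        - (∑ m : Fin k, if x (p m.succ) = false ∧ x (p m.castSucc) = true then F else 0)
        = (∑ m : Fin k, bval (x (p m.succ)) * F)
          - ∑ m : Fin k, bval (x (p m.castSucc)) * F := by
      rw [← Finset.sum_sub_distrib, ← Finset.sum_sub_distrib]
      refine Finset.sum_congr rfl fun m _ => ?_
      cases x (p m.castSucc) <;> cases x (p m.succ) <;> simp [bval]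
    linarith
  have hs : (if x (p 0) = true then F else 0) = bval (x (p 0)) * F := by
    cases x (p 0) <;> simp [bval]
  have ht : (if x (p (Fin.last k)) = false then F else 0)
      = F - bval (x (p (Fin.last k))) * F := by
    cases x (p (Fin.last k)) <;> simp [bval]
  linarith

/-- Let `Gs 0 = G, Gs 1, …, Gs (Fin.last K)` be a sequence of
networks in which each `Gs (m+1)` is the residual graph obtained from `Gs m`
by pushing a flow `F m ≥ 0` along some augmenting path of `Gs m`.  Then
`f_G(x) = f_{G^{(K+1)}}(x) + Σ_m F m` for every Boolean assignment `x`. -/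
theorem cutCost_push_flow_seq {ι : Type} [DecidableEq ι]
    (K : ℕ) (Gs : Fin (K + 1) → STNetwork ι)
    (F : Fin K → ℝ) (hF : ∀ m, 0 ≤ F m)
    (h : ∀ m : Fin K, IsResidualPush (Gs m.castSucc) (Gs m.succ) (F m))
    (x : ι → Bool) :
    cutCost (Gs 0) x = cutCost (Gs (Fin.last K)) x + ∑ m, F m := by
  induction K with
  | zero => simp
  | succ K ih =>
    have hlast := (h (Fin.last K)).cutCost_eq x
    have hinit := ih (fun m => Gs m.castSucc) (fun m => F m.castSucc)
      (fun m => hF m.castSucc) (fun m => h m.castSucc)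
    rw [Fin.sum_univ_castSucc]
    simp only [Fin.castSucc_zero, Fin.succ_last] at hinit hlast
    linarith
end
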